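/- Fix an integer N ≥ 1, ε > 0, and constants 0 < α ≤ β and M ≥ 0. Let a : ℝ^N → ℝ^{N×N} be continuously differentiable with a(x) symmetric, α|ξ|² ≤ a(x)ξ·ξ ≤ β|ξ|² for all x, ξ ∈ ℝ^N, and let c : ℝ^N → ℝ be continuous with |c(x)| ≤ M for all x. Let u : ℝ × ℝ^N → ℂ be smooth, such that for every compact interval I ⊂ ℝ the Schwartz seminorms of x ↦ u(t,x) and of x ↦ ∂_t u(t,x) are bounded uniformly for t ∈ I, and suppose that (i/ε) ∂_t u(t,x) − div(a(x)∇u(t,x)) + ε^{-2} c(x) u(t,x) = 0 holds at every (t,x) ∈ ℝ × ℝ^N. Then there exists a constant C > 0, depending only on α, β and M (and not on ε or t), such that ε ‖∇u(t,·)‖_{L²(ℝ^N)} ≤ C ( ‖u(0,·)‖_{L²(ℝ^N)} + ε ‖∇u(0,·)‖_{L²(ℝ^N)} ) for every t ∈ ℝ. -/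

import Mathlib

open MeasureTheory Real ComplexConjugate

/-- `u(t,·)` and `∂ₜu(t,·)` have Schwartz seminorms bounded uniformly on compact
time intervals. -/
def UnifSchwartz {N : ℕ} (w : ℝ → EuclideanSpace ℝ (Fin N) → ℂ) : Prop :=
  ∀ a b : ℝ, ∀ k n : ℕ, ∃ C : ℝ,
    ∀ t ∈ Set.Icc a b, ∀ x : EuclideanSpace ℝ (Fin N),
      ‖x‖ ^ k * ‖iteratedFDeriv ℝ n (w t) x‖ ≤ C

noncomputable def gw (N : ℕ) (x : EuclideanSpace ℝ (Fin N)) : ℝ := (1 + ‖x‖) ^ (-((N + 1 : ℕ) : ℝ))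

lemma gw_pos {N : ℕ} (x) : 0 < gw N x := by unfold gw; positivity
lemma gw_le {N : ℕ} (x) : gw N x ≤ 1 := by
  unfold gw
  apply Real.rpow_le_one_of_one_le_of_nonpos
  · linarith [norm_nonneg x]
  · exact neg_nonpos.mpr (Nat.cast_nonneg _)
lemma gw_int (N : ℕ) : Integrable (gw N) := by
  apply integrable_one_add_norm
  simp
lemma gw_bd {N : ℕ} (x : EuclideanSpace ℝ (Fin N)) (y A B : ℝ) (hy : 0 ≤ y) (h0 : y ≤ A) (h1 : ‖x‖ ^ (N+1) * y ≤ B) :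
    y ≤ (2 ^ N * (A + B)) * gw N x := by
  unfold gw
  rw [Real.rpow_neg (by positivity), Real.rpow_natCast, ← div_eq_mul_inv, le_div_iff₀ (by positivity)]
  have := add_pow_le (zero_le_one' ℝ) (norm_nonneg x) (N+1)
  simp only [Nat.add_sub_cancel, one_pow] at this
  calc y * (1 + ‖x‖)^(N+1) ≤ y * (2 ^ N * (1 + ‖x‖^(N+1))) := by gcongr
    _ = 2 ^ N * (y + ‖x‖^(N+1) * y) := by ring
    _ ≤ _ := by gcongr

lemma aux_bump (N : ℕ) : ∃ χ : EuclideanSpace ℝ (Fin N) → ℝ, ContDiff ℝ 1 χ ∧ HasCompactSupport χ ∧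
    (∀ x, |χ x| ≤ 1) ∧ (∀ x, ‖x‖ ≤ 1 → χ x = 1) := by
  let f : ContDiffBump (0 : EuclideanSpace ℝ (Fin N)) := ⟨1, 2, by norm_num, by norm_num⟩
  refine ⟨f, f.contDiff, f.hasCompactSupport, fun x => ?_, fun x hx => ?_⟩
  · rw [abs_of_nonneg f.nonneg]; exact f.le_one
  · apply f.one_of_mem_closedBall; simpa using hx

lemma aux_div_zero {N : ℕ} (V : Fin N → EuclideanSpace ℝ (Fin N) → ℂ)
    (hV : ∀ k, ContDiff ℝ 1 (V k)) (hi : ∀ k, Integrable (V k))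
    (hd : Integrable (fun x => ∑ k, fderiv ℝ (V k) x (EuclideanSpace.single k 1))) :
    ∫ x, ∑ k, fderiv ℝ (V k) x (EuclideanSpace.single k 1) = 0 := by
  obtain ⟨χ, hχ, hχs, hχ1, hχe⟩ := aux_bump N
  obtain ⟨K, hK⟩ := (hχs.fderiv (𝕜 := ℝ)).exists_bound_of_continuous (hχ.continuous_fderiv one_ne_zero)
  let δ : ℕ → ℝ := fun n => 1 / ((n : ℝ) + 1)
  have hδ : ∀ n, 0 < δ n := fun n => by simp only [δ]; positivity
  have hδ0 : Filter.Tendsto δ Filter.atTop (nhds 0) := tendsto_one_div_add_atTop_nhds_zero_nat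
  let X : ℕ → EuclideanSpace ℝ (Fin N) → ℝ := fun n x => χ (δ n • x)
  have hX : ∀ n, ContDiff ℝ 1 (X n) := fun n => hχ.comp (contDiff_const_smul (δ n))
  have hXs : ∀ n, HasCompactSupport (X n) := fun n => hχs.comp_smul (hδ n).ne'
  have hXd : ∀ n x v, fderiv ℝ (X n) x v = δ n * fderiv ℝ χ (δ n • x) v := by
    intro n x v
    have h1 : HasFDerivAt (fun x : EuclideanSpace ℝ (Fin N) => δ n • x)
      (δ n • ContinuousLinearMap.id ℝ _) x := (hasFDerivAt_id x).const_smul (δ n)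
    have h2 := ((hχ.differentiable one_ne_zero) (δ n • x)).hasFDerivAt.comp x h1
    have h3 : fderiv ℝ (X n) x = _ := h2.fderiv
    rw [h3]; simp
  have key : ∀ n, ∫ x, X n x • ∑ k, fderiv ℝ (V k) x (EuclideanSpace.single k 1)
      = - ∑ k, ∫ x, fderiv ℝ (X n) x (EuclideanSpace.single k 1) • V k x := by
    intro n
    have hint : ∀ k, Integrable (fun x => X n x • fderiv ℝ (V k) x (EuclideanSpace.single k 1)) := by
      intro k
      apply Continuous.integrable_of_hasCompactSupport
      · exact (hX n).continuous.smul (((hV k).continuous_fderiv one_ne_zero).clm_apply continuous_const)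
      · exact (hXs n).smul_right
    simp_rw [Finset.smul_sum]
    rw [integral_finsetSum _ (fun k _ => hint k), ← Finset.sum_neg_distrib]
    refine Finset.sum_congr rfl fun k _ => ?_
    apply integral_smul_fderiv_eq_neg_fderiv_smul_of_integrable
    · apply Continuous.integrable_of_hasCompactSupport
      · exact ((((hX n).continuous_fderiv one_ne_zero).clm_apply continuous_const)).smul (hV k).continuous
      · exact ((hXs n).fderiv_apply ℝ _).smul_right
    · exact hint k
    · apply Continuous.integrable_of_hasCompactSupport
      · exact (hX n).continuous.smul (hV k).continuous
      · exact (hXs n).smul_right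
    · exact fun x _ => (hX n).differentiable one_ne_zero x
    · exact fun x _ => (hV k).differentiable one_ne_zero x
  have lim1 : Filter.Tendsto (fun n => ∫ x, X n x • ∑ k, fderiv ℝ (V k) x (EuclideanSpace.single k 1))
      Filter.atTop (nhds (∫ x, ∑ k, fderiv ℝ (V k) x (EuclideanSpace.single k 1))) := by
    apply tendsto_integral_of_dominated_convergence _ _ hd.norm
    · intro n
      refine Filter.Eventually.of_forall fun x => ?_
      rw [norm_smul]
      exact mul_le_of_le_one_left (norm_nonneg _) (hχ1 _)
    · refine Filter.Eventually.of_forall fun x => ?_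
      apply tendsto_const_nhds.congr'
      have : Filter.Tendsto (fun n => δ n * ‖x‖) Filter.atTop (nhds (0 * ‖x‖)) := hδ0.mul_const _
      rw [zero_mul] at this
      filter_upwards [this.eventually (gt_mem_nhds one_pos)] with n hn
      have : X n x = 1 := by
        apply hχe; rw [norm_smul, Real.norm_of_nonneg (hδ n).le]; exact hn.le
      rw [this, one_smul]
    · intro n
      exact (hX n).continuous.aestronglyMeasurable.smul hd.aestronglyMeasurable
  have lim2 : Filter.Tendsto (fun n => - ∑ k, ∫ x, fderiv ℝ (X n) x (EuclideanSpace.single k 1) • V k x)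
      Filter.atTop (nhds 0) := by
    rw [← neg_zero, ← Finset.sum_const_zero (s := (Finset.univ : Finset (Fin N)))]
    apply Filter.Tendsto.neg
    apply tendsto_finsetSum
    intro k _
    have : Filter.Tendsto (fun n => δ n * (K * ∫ x, ‖V k x‖)) Filter.atTop (nhds (0 * (K * ∫ x, ‖V k x‖))) := hδ0.mul_const _
    rw [zero_mul] at this
    refine squeeze_zero_norm (fun n => ?_) this
    rw [← integral_const_mul, ← integral_const_mul]
    apply norm_integral_le_of_norm_le (((hi k).norm.const_mul _).const_mul _)
    refine Filter.Eventually.of_forall fun x => ?_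
    rw [norm_smul, hXd, norm_mul, Real.norm_of_nonneg (hδ n).le, mul_assoc]
    have h1 := (fderiv ℝ χ (δ n • x)).le_of_opNorm_le (hK _) (EuclideanSpace.single k 1)
    simp only [PiLp.norm_single, norm_one, mul_one] at h1
    have := (hδ n).le
    gcongr
  simp_rw [key] at lim1
  exact tendsto_nhds_unique lim1 lim2

lemma unif_bd {N : ℕ} {w : ℝ → EuclideanSpace ℝ (Fin N) → ℂ} (hw : UnifSchwartz w) (a b : ℝ) :
    ∃ C, 0 ≤ C ∧ ∀ t ∈ Set.Icc a b, ∀ x, ‖w t x‖ ≤ C * gw N x ∧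
      ∀ k, ‖fderiv ℝ (w t) x (EuclideanSpace.single k 1)‖ ≤ C * gw N x := by
  obtain ⟨A0, h0⟩ := hw a b 0 0
  obtain ⟨B0, h0'⟩ := hw a b (N+1) 0
  obtain ⟨A1, h1⟩ := hw a b 0 1
  obtain ⟨B1, h1'⟩ := hw a b (N+1) 1
  simp only [pow_zero, one_mul, norm_iteratedFDeriv_zero, norm_iteratedFDeriv_one] at h0 h0' h1 h1'
  refine ⟨max 0 (max (2 ^ N * (A0 + B0)) (2 ^ N * (A1 + B1))), le_max_left _ _, fun t ht x => ⟨?_, fun k => ?_⟩⟩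
  · refine (gw_bd x _ _ _ (norm_nonneg _) (h0 t ht x) (h0' t ht x)).trans ?_
    exact mul_le_mul_of_nonneg_right ((le_max_left _ _).trans (le_max_right _ _)) (gw_pos x).le
  · have h2 := (fderiv ℝ (w t) x).le_opNorm (EuclideanSpace.single k 1)
    simp only [PiLp.norm_single, norm_one, mul_one] at h2
    refine h2.trans ?_
    refine (gw_bd x _ _ _ (norm_nonneg _) (h1 t ht x) (h1' t ht x)).trans ?_
    exact mul_le_mul_of_nonneg_right ((le_max_right _ _).trans (le_max_right _ _)) (gw_pos x).le

lemma gw_integrable {N : ℕ} {G : Type*} [NormedAddCommGroup G] {f : EuclideanSpace ℝ (Fin N) → G}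
    (hf : Continuous f) (C : ℝ)
    (h : ∀ x, ‖f x‖ ≤ C * gw N x) : Integrable f :=
  ((gw_int N).const_mul C).mono' (hf.aestronglyMeasurable) (Filter.Eventually.of_forall h)

lemma cons_aux {N : ℕ} (f f' : ℝ → EuclideanSpace ℝ (Fin N) → ℝ)
    (hf : ∀ t, Continuous (f t)) (hf' : ∀ t, Continuous (f' t))
    (hd : ∀ t x, HasDerivAt (fun s => f s x) (f' t x) t)
    (hb : ∀ t, ∃ C, ∀ s ∈ Set.Icc (t-1) (t+1), ∀ x, ‖f s x‖ ≤ C * gw N x ∧ ‖f' s x‖ ≤ C * gw N x)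
    (h0 : ∀ t, ∫ x, f' t x = 0) (t : ℝ) : ∫ x, f t x = ∫ x, f 0 x := by
  have key : ∀ t, HasDerivAt (fun s => ∫ x, f s x) 0 t := by
    intro t
    obtain ⟨C, hC⟩ := hb t
    have := (hasDerivAt_integral_of_dominated_loc_of_deriv_le (μ := volume) (F := f) (F' := f') (x₀ := t)
      (s := Set.Icc (t-1) (t+1)) (bound := fun x => C * gw N x)
      (Icc_mem_nhds (by linarith) (by linarith))
      (Filter.Eventually.of_forall fun s => (hf s).aestronglyMeasurable)
      (gw_integrable (hf t) C fun x => (hC t (by constructor <;> linarith) x).1)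
      (hf' t).aestronglyMeasurable
      (Filter.Eventually.of_forall fun x s hs => (hC s hs x).2)
      ((gw_int N).const_mul C)
      (Filter.Eventually.of_forall fun x s hs => hd s x)).2
    rwa [h0 t] at this
  exact is_const_of_deriv_eq_zero (fun t => (key t).differentiableAt) (fun t => (key t).deriv) t 0

noncomputable def aS {N : ℕ} (A : Fin N → Fin N → ℝ) (p q : Fin N → ℂ) : ℂ :=
  ∑ k, conj (p k) * ∑ l, (A k l : ℂ) * q l

lemma aS_symm {N : ℕ} (A : Fin N → Fin N → ℝ) (hA : ∀ k l, A k l = A l k) (p q : Fin N → ℂ) :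
    aS A p q = conj (aS A q p) := by
  simp only [aS, map_sum, map_mul, Complex.conj_conj, Complex.conj_ofReal, Finset.mul_sum]
  rw [Finset.sum_comm]
  refine Finset.sum_congr rfl fun k _ => Finset.sum_congr rfl fun l _ => ?_
  rw [hA k l]; ring

lemma aS_im {N : ℕ} (A : Fin N → Fin N → ℝ) (hA : ∀ k l, A k l = A l k) (p : Fin N → ℂ) :
    (aS A p p).im = 0 :=
  Complex.conj_eq_iff_im.mp (aS_symm A hA p p).symm

lemma aS_re {N : ℕ} (A : Fin N → Fin N → ℝ) (p : Fin N → ℂ) :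
    (aS A p p).re = ∑ k, ∑ l, A k l * (p l).re * (p k).re + ∑ k, ∑ l, A k l * (p l).im * (p k).im := by
  simp only [aS, Complex.re_sum, Finset.mul_sum, ← Finset.sum_add_distrib]
  refine Finset.sum_congr rfl fun k _ => Finset.sum_congr rfl fun l _ => ?_
  simp; ring

lemma sum_normsq {N : ℕ} (p : Fin N → ℂ) : ∑ k, ‖p k‖^2 = ∑ k, (p k).re^2 + ∑ k, (p k).im^2 := by
  rw [← Finset.sum_add_distrib]
  refine Finset.sum_congr rfl fun k _ => ?_
  rw [Complex.sq_norm, Complex.normSq_apply]; ring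

lemma aS_norm {N : ℕ} (A : Fin N → Fin N → ℝ) (β : ℝ) (hA : ∀ k l, |A k l| ≤ β) (p q : Fin N → ℂ) (P Q : ℝ)
    (hP : 0 ≤ P) (_hQ : 0 ≤ Q) (hβ : 0 ≤ β)
    (hp : ∀ k, ‖p k‖ ≤ P) (hq : ∀ k, ‖q k‖ ≤ Q) : ‖aS A p q‖ ≤ N * (P * (N * (β * Q))) := by
  unfold aS
  refine (norm_sum_le _ _).trans ?_
  have : ∀ k ∈ (Finset.univ : Finset (Fin N)), ‖conj (p k) * ∑ l, (A k l : ℂ) * q l‖ ≤ P * (N * (β * Q)) := by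
    intro k _
    rw [norm_mul, RCLike.norm_conj]
    gcongr
    · exact hp k
    · refine (norm_sum_le _ _).trans ?_
      have : ∀ l ∈ (Finset.univ : Finset (Fin N)), ‖(A k l : ℂ) * q l‖ ≤ β * Q := by
        intro l _
        rw [norm_mul, Complex.norm_real]
        gcongr
        · exact hA k l
        · exact hq l
      simpa using Finset.sum_le_card_nsmul _ _ _ this
  simpa using Finset.sum_le_card_nsmul _ _ _ this

lemma entry_bd {N : ℕ} (A : Fin N → Fin N → ℝ) (hA : ∀ k l, A k l = A l k) (α β : ℝ) (hα : 0 < α)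
    (h : ∀ ξ : Fin N → ℝ, α * ∑ i : Fin N, ξ i ^ 2 ≤ ∑ k : Fin N, ∑ l : Fin N, A k l * ξ l * ξ k ∧
          ∑ k : Fin N, ∑ l : Fin N, A k l * ξ l * ξ k ≤ β * ∑ i : Fin N, ξ i ^ 2) (k l) : |A k l| ≤ β := by
  have hd : ∀ k, α ≤ A k k ∧ A k k ≤ β := by
    intro k
    have := h (Pi.single k 1)
    simpa [Pi.single_apply, Finset.sum_ite_eq] using this
  by_cases hkl : k = l
  · subst hkl; rw [abs_of_pos (hα.trans_le (hd k).1)]; exact (hd k).2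
  · have e1 : ∑ i, (Pi.single k 1 + Pi.single l 1 : Fin N → ℝ) i ^ 2 = 2 := by
      have : ∀ i, (Pi.single k 1 + Pi.single l 1 : Fin N → ℝ) i ^ 2 = (if i = k then 1 else 0) + (if i = l then 1 else 0) := by
        intro i
        simp only [Pi.add_apply, Pi.single_apply]
        split_ifs with h1 h2 <;> simp_all
      simp only [this, Finset.sum_add_distrib]
      simp; norm_num
    have e2 : ∑ i, ∑ j, A i j * (Pi.single k 1 + Pi.single l 1 : Fin N → ℝ) j * (Pi.single k 1 + Pi.single l 1 : Fin N → ℝ) i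
        = A k k + A l l + 2 * A k l := by
      simp only [Pi.add_apply, Pi.single_apply, mul_add, Finset.sum_add_distrib, add_mul]
      simp [hA l k]; ring
    have h1 := h (Pi.single k 1 + Pi.single l 1)
    rw [e1, e2] at h1
    have := hd k; have := hd l
    rw [abs_le]; constructor <;> linarith

lemma smooth_facts {N : ℕ} (u : ℝ → EuclideanSpace ℝ (Fin N) → ℂ)
    (hU : ContDiff ℝ (⊤ : ℕ∞) (Function.uncurry u)) :
    (∀ t, ContDiff ℝ 2 (u t)) ∧
    (∀ t x, HasDerivAt (fun s => u s x) (deriv (fun s => u s x) t) t) ∧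
    (∀ t, ContDiff ℝ 1 (fun x => deriv (fun s => u s x) t)) ∧
    (∀ t x e, HasDerivAt (fun s => fderiv ℝ (u s) x e)
      (fderiv ℝ (fun y => deriv (fun s => u s y) t) x e) t) := by
  have hUd : Differentiable ℝ (Function.uncurry u) := hU.differentiable (by simp)
  have hD : ContDiff ℝ 1 (fderiv ℝ (Function.uncurry u)) :=
    (contDiff_infty.1 hU 2).fderiv_right (by norm_num)
  have hDd : Differentiable ℝ (fderiv ℝ (Function.uncurry u)) := hD.differentiable one_ne_zero
  have ht : ∀ (x : EuclideanSpace ℝ (Fin N)) (t : ℝ),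
      HasDerivAt (fun s : ℝ => (s, x)) ((1 : ℝ), (0 : EuclideanSpace ℝ (Fin N))) t :=
    fun x t => (hasDerivAt_id t).prodMk (hasDerivAt_const t x)
  have hx : ∀ (t : ℝ) (x : EuclideanSpace ℝ (Fin N)),
      HasFDerivAt (fun y => (t, y)) (ContinuousLinearMap.inr ℝ ℝ (EuclideanSpace ℝ (Fin N))) x :=
    fun t x => hasFDerivAt_prodMk_right t x
  have d1 : ∀ t x, HasDerivAt (fun s => u s x) (fderiv ℝ (Function.uncurry u) (t, x) (1, 0)) t :=
    fun t x => HasFDerivAt.comp_hasDerivAt (l := Function.uncurry u) (f := fun s : ℝ => (s, x)) t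
      (hUd (t, x)).hasFDerivAt (ht x t)
  have d2 : ∀ t x, HasFDerivAt (u t) ((fderiv ℝ (Function.uncurry u) (t, x)).comp
      (ContinuousLinearMap.inr ℝ ℝ _)) x :=
    fun t x => (hUd (t, x)).hasFDerivAt.comp x (hx t x)
  have ev : (fun t x => deriv (fun s => u s x) t) =
      fun t x => fderiv ℝ (Function.uncurry u) (t, x) (1, 0) := by
    funext t x; exact (d1 t x).deriv
  have ev' : ∀ t x, deriv (fun s => u s x) t = fderiv ℝ (Function.uncurry u) (t, x) (1, 0) :=
    fun t x => (d1 t x).deriv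
  refine ⟨fun t => ?_, fun t x => (d1 t x).differentiableAt.hasDerivAt, fun t => ?_, fun t x e => ?_⟩
  · exact (contDiff_infty.1 hU 2).comp (contDiff_prodMk_right t)
  · simp only [ev']
    exact (hD.comp (contDiff_prodMk_right t)).clm_apply contDiff_const
  · simp only [ev']
    have e1 : (fun s => fderiv ℝ (u s) x e) =
        fun s => fderiv ℝ (Function.uncurry u) (s, x) (0, e) := by
      funext s; rw [(d2 s x).fderiv]; simp
    rw [e1]
    have h1a : HasDerivAt (fun s => fderiv ℝ (Function.uncurry u) (s, x)) _ t :=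
      HasFDerivAt.comp_hasDerivAt (l := fderiv ℝ (Function.uncurry u))
      (f := fun s : ℝ => (s, x)) t (hDd (t, x)).hasFDerivAt (ht x t)
    have h1 := h1a.clm_apply (hasDerivAt_const t ((0 : ℝ), e))
    have h2a : HasFDerivAt (fun y => fderiv ℝ (Function.uncurry u) (t, y)) _ x :=
      HasFDerivAt.comp (g := fderiv ℝ (Function.uncurry u)) (f := fun y => (t, y)) x
      (hDd (t, x)).hasFDerivAt (hx t x)
    have h2 := h2a.clm_apply
      (hasFDerivAt_const ((1 : ℝ), (0 : EuclideanSpace ℝ (Fin N))) x)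
    have sy : IsSymmSndFDerivAt ℝ (Function.uncurry u) (t, x) :=
      (contDiff_infty.1 hU 2).contDiffAt.isSymmSndFDerivAt (by simp)
    have h3 := h2.fderiv
    rw [h3]
    refine h1.congr_deriv ?_
    simp
    exact sy _ _

lemma ibp_aux {N : ℕ} (a : EuclideanSpace ℝ (Fin N) → Fin N → Fin N → ℝ)
    (ha : ∀ k l, ContDiff ℝ 1 (fun x => a x k l)) (β : ℝ) (hβ : 0 ≤ β) (hab : ∀ x k l, |a x k l| ≤ β)
    (u w : EuclideanSpace ℝ (Fin N) → ℂ) (hu : ContDiff ℝ 2 u) (hw : ContDiff ℝ 1 w)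
    (C : ℝ) (hC : 0 ≤ C) (hwb : ∀ x, ‖w x‖ ≤ C * gw N x)
    (hwb' : ∀ x k, ‖fderiv ℝ w x (EuclideanSpace.single k 1)‖ ≤ C * gw N x)
    (hub' : ∀ x k, ‖fderiv ℝ u x (EuclideanSpace.single k 1)‖ ≤ C * gw N x)
    (D : EuclideanSpace ℝ (Fin N) → ℂ)
    (hDe : ∀ x, D x = ∑ k : Fin N, fderiv ℝ
                (fun y => ∑ l : Fin N, (a y k l : ℂ) * fderiv ℝ u y (EuclideanSpace.single l 1))
                x (EuclideanSpace.single k 1))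
    (K : ℝ) (hDb : ∀ x, ‖D x‖ ≤ K) :
    Integrable (fun x => conj (w x) * D x
      + aS (a x) (fun k => fderiv ℝ w x (EuclideanSpace.single k 1))
        (fun k => fderiv ℝ u x (EuclideanSpace.single k 1))) ∧
    ∫ x, (conj (w x) * D x
      + aS (a x) (fun k => fderiv ℝ w x (EuclideanSpace.single k 1))
        (fun k => fderiv ℝ u x (EuclideanSpace.single k 1))) = 0 := by
  set F : Fin N → EuclideanSpace ℝ (Fin N) → ℂ := fun k y =>
    ∑ l : Fin N, (a y k l : ℂ) * fderiv ℝ u y (EuclideanSpace.single l 1) with hF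
  have hu1 : ContDiff ℝ 1 (fderiv ℝ u) := hu.fderiv_right (by norm_num)
  have hFc : ∀ k, ContDiff ℝ 1 (F k) := by
    intro k
    apply ContDiff.sum
    intro l _
    exact (Complex.ofRealCLM.contDiff.comp (ha k l)).mul (hu1.clm_apply contDiff_const)
  have hcw : ContDiff ℝ 1 (fun x => conj (w x)) := Complex.conjCLE.contDiff.comp hw
  have hcd : ∀ x e, fderiv ℝ (fun x => conj (w x)) x e = conj (fderiv ℝ w x e) := by
    intro x e
    have := (Complex.conjCLE.toContinuousLinearMap.hasFDerivAt (x := w x)).comp x (hw.differentiable one_ne_zero x).hasFDerivAt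
    have h := this.fderiv
    have h' : fderiv ℝ (fun x => conj (w x)) x = _ := h
    rw [h']; simp
  have e : (fun x => conj (w x) * D x
      + aS (a x) (fun k => fderiv ℝ w x (EuclideanSpace.single k 1))
        (fun k => fderiv ℝ u x (EuclideanSpace.single k 1))) =
      fun x => ∑ k, fderiv ℝ (fun y => conj (w y) * F k y) x (EuclideanSpace.single k 1) := by
    funext x
    rw [hDe, Finset.mul_sum, aS, ← Finset.sum_add_distrib]
    refine Finset.sum_congr rfl fun k _ => ?_
    rw [fderiv_fun_mul (hcw.differentiable one_ne_zero x) ((hFc k).differentiable one_ne_zero x)]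
    simp only [add_apply, smul_apply, hcd, smul_eq_mul, hF]
    ring
  have hVc : ∀ k, ContDiff ℝ 1 (fun y => conj (w y) * F k y) := fun k => hcw.mul (hFc k)
  have hcont : Continuous (fun x => ∑ k, fderiv ℝ (fun y => conj (w y) * F k y) x (EuclideanSpace.single k 1)) :=
    continuous_finsetSum _ fun k _ => ((hVc k).continuous_fderiv one_ne_zero).clm_apply continuous_const
  have hg1 : ∀ x, C * gw N x ≤ C := fun x => mul_le_of_le_one_right hC (gw_le x)
  have hg0 : ∀ x, 0 ≤ C * gw N x := fun x => mul_nonneg hC (gw_pos x).le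
  have hFb : ∀ k x, ‖F k x‖ ≤ N * (β * C) := by
    intro k x
    refine (norm_sum_le _ _).trans ?_
    have : ∀ l ∈ (Finset.univ : Finset (Fin N)), ‖(a x k l : ℂ) * fderiv ℝ u x (EuclideanSpace.single l 1)‖ ≤ β * C := by
      intro l _
      rw [norm_mul, Complex.norm_real]
      gcongr
      · exact hab x k l
      · exact (hub' x l).trans (hg1 x)
    simpa using Finset.sum_le_card_nsmul _ _ _ this
  have hint : Integrable (fun x => conj (w x) * D x
      + aS (a x) (fun k => fderiv ℝ w x (EuclideanSpace.single k 1))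
        (fun k => fderiv ℝ u x (EuclideanSpace.single k 1))) := by
    apply gw_integrable (e ▸ hcont) (C * K + N * (C * (N * (β * C))))
    intro x
    refine (norm_add_le _ _).trans ?_
    have h1 : ‖conj (w x) * D x‖ ≤ C * gw N x * K := by
      rw [norm_mul, RCLike.norm_conj]
      have := hg0 x
      gcongr
      · exact hwb x
      · exact hDb x
    have h2 := aS_norm (a x) β (hab x) _ _ (C * gw N x) C (hg0 x) hC hβ (hwb' x) (fun k => (hub' x k).trans (hg1 x))
    refine (add_le_add h1 h2).trans (le_of_eq ?_)
    ring
  refine ⟨hint, ?_⟩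
  rw [e] at hint ⊢
  apply aux_div_zero _ hVc _ hint
  intro k
  apply gw_integrable (hVc k).continuous (C * (N * (β * C)))
  intro x
  rw [norm_mul, RCLike.norm_conj]
  have := hg0 x
  calc ‖w x‖ * ‖F k x‖ ≤ (C * gw N x) * (N * (β * C)) := by
        gcongr
        · exact hwb x
        · exact hFb k x
    _ = _ := by ring

lemma aS_cont {N : ℕ} {X : Type*} [TopologicalSpace X] (a : X → Fin N → Fin N → ℝ)
    (ha : ∀ k l, Continuous (fun x => a x k l)) (p q : X → Fin N → ℂ)
    (hp : ∀ k, Continuous (fun x => p x k)) (hq : ∀ k, Continuous (fun x => q x k)) :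
    Continuous (fun x => aS (a x) (p x) (q x)) := by
  unfold aS
  refine continuous_finsetSum _ fun k _ => ?_
  refine (Complex.continuous_conj.comp (hp k)).mul (continuous_finsetSum _ fun l _ => ?_)
  exact (Complex.continuous_ofReal.comp (ha k l)).mul (hq l)

lemma aS_deriv {N : ℕ} (A : Fin N → Fin N → ℝ) (hA : ∀ k l, A k l = A l k)
    (p : ℝ → Fin N → ℂ) (p' : Fin N → ℂ) (t : ℝ)
    (hp : ∀ k, HasDerivAt (fun s => p s k) (p' k) t) :
    HasDerivAt (fun s => (aS A (p s) (p s)).re) (2 * (aS A p' (p t)).re) t := by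
  have h1 : HasDerivAt (fun s => aS A (p s) (p s)) (aS A p' (p t) + aS A (p t) p') t := by
    unfold aS
    rw [← Finset.sum_add_distrib]
    refine HasDerivAt.fun_sum fun k _ => ?_
    have hc : HasDerivAt (fun s => conj (p s k)) (conj (p' k)) t :=
      Complex.conjCLE.toContinuousLinearMap.hasFDerivAt.comp_hasDerivAt t (hp k)
    exact hc.mul (HasDerivAt.fun_sum fun l _ => (hp l).const_mul _)
  have h2 : HasDerivAt (fun s => (aS A (p s) (p s)).re) ((aS A p' (p t) + aS A (p t) p').re) t :=
    Complex.reCLM.hasFDerivAt.comp_hasDerivAt t h1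
  refine h2.congr_deriv ?_
  rw [aS_symm A hA (p t) p', Complex.add_re, Complex.conj_re]; ring

lemma final_aux (α β M ε Z G G0 : ℝ) (hα : 0 < α) (hβ : 0 ≤ β) (hM : 0 ≤ M) (hε : 0 < ε)
    (hZ : 0 ≤ Z) (hG : 0 ≤ G) (hG0 : 0 ≤ G0)
    (h : α * G - (ε ^ 2)⁻¹ * M * Z ≤ β * G0 + (ε ^ 2)⁻¹ * M * Z) :
    ε * √G ≤ √((β + 2 * M) / α) * (√Z + ε * √G0) := by
  have hz := Real.sq_sqrt hZ
  have hg := Real.sq_sqrt hG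
  have hg0 := Real.sq_sqrt hG0
  have hq : 0 ≤ (β + 2 * M) / α := by positivity
  rw [← pow_le_pow_iff_left₀ (by positivity) (by positivity) two_ne_zero, mul_pow, mul_pow,
    Real.sq_sqrt hq, hg, div_mul_eq_mul_div, le_div_iff₀ hα]
  have h2 : ε ^ 2 * (α * G) ≤ ε ^ 2 * (β * G0) + 2 * M * Z := by
    have := mul_le_mul_of_nonneg_left h (sq_nonneg ε)
    have e : ε ^ 2 * (ε ^ 2)⁻¹ = 1 := mul_inv_cancel₀ (by positivity)
    linear_combination this + 2 * M * Z * e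
  have h3 : Z + ε ^ 2 * G0 ≤ (√Z + ε * √G0) ^ 2 := by
    have : 0 ≤ √Z * (ε * √G0) := by positivity
    nlinarith
  calc ε ^ 2 * G * α ≤ ε ^ 2 * (β * G0) + 2 * M * Z := by linarith
    _ ≤ (β + 2 * M) * (Z + ε ^ 2 * G0) := by
      have h1 : 0 ≤ β * Z := by positivity
      have h2 : 0 ≤ M * (ε ^ 2 * G0) := by positivity
      nlinarith
    _ ≤ _ := by gcongr

theorem gradient_a_priori_estimate_eps_schrodinger
    (α β M : ℝ) (hα : 0 < α) (hαβ : α ≤ β) (hM : 0 ≤ M) :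
    ∃ C : ℝ, 0 < C ∧
      ∀ (N : ℕ), 1 ≤ N → ∀ (ε : ℝ), 0 < ε →
      ∀ (a : EuclideanSpace ℝ (Fin N) → Fin N → Fin N → ℝ),
        (∀ k l, ContDiff ℝ 1 (fun x => a x k l)) →
        (∀ x k l, a x k l = a x l k) →
        (∀ (x : EuclideanSpace ℝ (Fin N)) (ξ : Fin N → ℝ),
          α * ∑ i : Fin N, ξ i ^ 2 ≤ ∑ k : Fin N, ∑ l : Fin N, a x k l * ξ l * ξ k ∧
          ∑ k : Fin N, ∑ l : Fin N, a x k l * ξ l * ξ k ≤ β * ∑ i : Fin N, ξ i ^ 2) →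
      ∀ (c : EuclideanSpace ℝ (Fin N) → ℝ), Continuous c → (∀ x, |c x| ≤ M) →
      ∀ (u : ℝ → EuclideanSpace ℝ (Fin N) → ℂ),
        ContDiff ℝ (⊤ : ℕ∞) (Function.uncurry u) →
        UnifSchwartz u →
        UnifSchwartz (fun t x => deriv (fun s => u s x) t) →
        (∀ t : ℝ, ∀ x : EuclideanSpace ℝ (Fin N),
          (Complex.I / (ε : ℂ)) * deriv (fun s => u s x) t
            - (∑ k : Fin N, fderiv ℝ
                (fun w => ∑ l : Fin N, (a w k l : ℂ)
                  * fderiv ℝ (u t) w (EuclideanSpace.single l 1))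
                x (EuclideanSpace.single k 1))
            + ((ε : ℂ) ^ 2)⁻¹ * (c x : ℂ) * u t x = 0) →
      ∀ t : ℝ,
        ε * Real.sqrt (∫ x : EuclideanSpace ℝ (Fin N),
            ∑ j : Fin N, ‖fderiv ℝ (u t) x (EuclideanSpace.single j 1)‖ ^ 2) ≤
          C * (Real.sqrt (∫ x : EuclideanSpace ℝ (Fin N), ‖u 0 x‖ ^ 2)
            + ε * Real.sqrt (∫ x : EuclideanSpace ℝ (Fin N),
                ∑ j : Fin N, ‖fderiv ℝ (u 0) x (EuclideanSpace.single j 1)‖ ^ 2)) := by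
  have hβ : 0 < β := hα.trans_le hαβ
  refine ⟨√((β + 2 * M) / α), Real.sqrt_pos.mpr (by positivity), ?_⟩
  intro N _ ε hε a ha has hell c hc hcM u hU hS1 hS2 hpde t
  obtain ⟨hu2, hut, hv1, hmix⟩ := smooth_facts u hU
  have hab : ∀ x k l, |a x k l| ≤ β := fun x k l => entry_bd (a x) (has x) α β hα (hell x) k l
  set v : ℝ → EuclideanSpace ℝ (Fin N) → ℂ := fun t x => deriv (fun s => u s x) t with hvdef
  let p : ℝ → EuclideanSpace ℝ (Fin N) → Fin N → ℂ := fun t x k =>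
    fderiv ℝ (u t) x (EuclideanSpace.single k 1)
  let q : ℝ → EuclideanSpace ℝ (Fin N) → Fin N → ℂ := fun t x k =>
    fderiv ℝ (v t) x (EuclideanSpace.single k 1)
  let D : ℝ → EuclideanSpace ℝ (Fin N) → ℂ := fun t x => ∑ k : Fin N, fderiv ℝ
                (fun w => ∑ l : Fin N, (a w k l : ℂ)
                  * fderiv ℝ (u t) w (EuclideanSpace.single l 1))
                x (EuclideanSpace.single k 1)
  have hεc : (ε : ℂ) ≠ 0 := by exact_mod_cast hε.ne'
  have hD : ∀ t x, D t x = Complex.I * ((ε⁻¹ : ℝ) : ℂ) * v t x + (((ε ^ 2)⁻¹ * c x : ℝ) : ℂ) * u t x := by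
    intro t x
    have := hpde t x
    push_cast
    linear_combination -this
  -- uniform bounds
  have hbd : ∀ t, ∃ C, 0 ≤ C ∧ ∀ s ∈ Set.Icc (t-1) (t+1), ∀ x, ‖u s x‖ ≤ C * gw N x ∧
      ‖v s x‖ ≤ C * gw N x ∧ (∀ k, ‖p s x k‖ ≤ C * gw N x) ∧ (∀ k, ‖q s x k‖ ≤ C * gw N x) := by
    intro t
    obtain ⟨C1, h1, h1'⟩ := unif_bd hS1 (t-1) (t+1)
    obtain ⟨C2, h2, h2'⟩ := unif_bd hS2 (t-1) (t+1)
    have m1 : ∀ x, C1 * gw N x ≤ max C1 C2 * gw N x := fun x =>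
      mul_le_mul_of_nonneg_right (le_max_left _ _) (gw_pos x).le
    have m2 : ∀ x, C2 * gw N x ≤ max C1 C2 * gw N x := fun x =>
      mul_le_mul_of_nonneg_right (le_max_right _ _) (gw_pos x).le
    exact ⟨max C1 C2, h1.trans (le_max_left _ _), fun s hs x =>
      ⟨(h1' s hs x).1.trans (m1 x), (h2' s hs x).1.trans (m2 x),
       fun k => ((h1' s hs x).2 k).trans (m1 x), fun k => ((h2' s hs x).2 k).trans (m2 x)⟩⟩
  have hself : ∀ t : ℝ, t ∈ Set.Icc (t-1) (t+1) := fun t => by constructor <;> linarith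
  have hprod : ∀ (C : ℝ) (x : EuclideanSpace ℝ (Fin N)) (y z : ℝ), 0 ≤ C → 0 ≤ y → 0 ≤ z →
      y ≤ C * gw N x → z ≤ C * gw N x → y * z ≤ C * C * gw N x := by
    intro C x y z hC hy hz h1 h2
    have : z ≤ C := h2.trans (mul_le_of_le_one_right hC (gw_le x))
    calc y * z ≤ (C * gw N x) * C := mul_le_mul h1 this hz (mul_nonneg hC (gw_pos x).le)
      _ = _ := by ring
  -- continuity
  have cu : ∀ t, Continuous (u t) := fun t => (hu2 t).continuous
  have cv : ∀ t, Continuous (v t) := fun t => (hv1 t).continuous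
  have cp : ∀ t k, Continuous (fun x => p t x k) := fun t k =>
    ((hu2 t).continuous_fderiv two_ne_zero).clm_apply continuous_const
  have cq : ∀ t k, Continuous (fun x => q t x k) := fun t k =>
    ((hv1 t).continuous_fderiv one_ne_zero).clm_apply continuous_const
  have ca : ∀ k l, Continuous (fun x => a x k l) := fun k l => (ha k l).continuous
  -- divergence bound
  have hDb : ∀ t, ∃ K, ∀ x, ‖D t x‖ ≤ K := by
    intro t
    obtain ⟨C, hC, hb⟩ := hbd t
    refine ⟨ε⁻¹ * C + (ε ^ 2)⁻¹ * M * C, fun x => ?_⟩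
    obtain ⟨b1, b2, -, -⟩ := hb t (hself t) x
    have hg1 : C * gw N x ≤ C := mul_le_of_le_one_right hC (gw_le x)
    rw [hD]
    refine (norm_add_le _ _).trans (add_le_add ?_ ?_)
    · rw [norm_mul, norm_mul, Complex.norm_I, one_mul, Complex.norm_real,
        Real.norm_of_nonneg (by positivity)]
      gcongr
      exact b2.trans hg1
    · rw [norm_mul, Complex.norm_real, norm_mul, Real.norm_of_nonneg (by positivity : 0 ≤ (ε^2)⁻¹)]
      gcongr
      · exact hcM x
      · exact b1.trans hg1
  -- integrations by parts
  have ibp1 : ∀ t, Integrable (fun x => conj (u t x) * D t x + aS (a x) (p t x) (p t x)) ∧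
      ∫ x, (conj (u t x) * D t x + aS (a x) (p t x) (p t x)) = 0 := by
    intro t
    obtain ⟨C, hC, hb⟩ := hbd t
    obtain ⟨K, hK⟩ := hDb t
    exact ibp_aux a ha β hβ.le hab (u t) (u t) (hu2 t) ((hu2 t).of_le (by norm_num)) C hC
      (fun x => (hb t (hself t) x).1) (fun x => (hb t (hself t) x).2.2.1)
      (fun x => (hb t (hself t) x).2.2.1) (D t) (fun x => rfl) K hK
  have ibp2 : ∀ t, Integrable (fun x => conj (v t x) * D t x + aS (a x) (q t x) (p t x)) ∧
      ∫ x, (conj (v t x) * D t x + aS (a x) (q t x) (p t x)) = 0 := by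
    intro t
    obtain ⟨C, hC, hb⟩ := hbd t
    obtain ⟨K, hK⟩ := hDb t
    exact ibp_aux a ha β hβ.le hab (u t) (v t) (hu2 t) (hv1 t) C hC
      (fun x => (hb t (hself t) x).2.1) (fun x => (hb t (hself t) x).2.2.2)
      (fun x => (hb t (hself t) x).2.2.1) (D t) (fun x => rfl) K hK
  -- derivative of the L2 density
  have dnorm : ∀ t x, HasDerivAt (fun s => ‖u s x‖ ^ 2) (2 * (conj (u t x) * v t x).re) t := by
    intro t x
    have := (hut t x).norm_sq
    rw [Complex.inner, mul_comm (v t x)] at this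
    exact this
  have nsq : ∀ z : ℂ, conj z * z = ((‖z‖ ^ 2 : ℝ) : ℂ) := by
    intro z; rw [Complex.conj_mul']; push_cast; rfl
  have consL2 : ∀ t, ∫ x, ‖u t x‖ ^ 2 = ∫ x, ‖u 0 x‖ ^ 2 := by
    refine cons_aux (fun t x => ‖u t x‖ ^ 2) (fun t x => 2 * (conj (u t x) * v t x).re)
      (fun t => (cu t).norm.pow 2)
      (fun t => continuous_const.mul (Complex.continuous_re.comp
        ((Complex.continuous_conj.comp (cu t)).mul (cv t)))) dnorm ?_ ?_
    · intro t
      obtain ⟨C, hC, hb⟩ := hbd t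
      refine ⟨2 * (C * C), fun s hs x => ?_⟩
      obtain ⟨b1, b2, -, -⟩ := hb s hs x
      have g0 := gw_pos x
      have P1 := hprod C x _ _ hC (norm_nonneg _) (norm_nonneg _) b1 b1
      have P2 := hprod C x _ _ hC (norm_nonneg _) (norm_nonneg _) b1 b2
      have P0 : 0 ≤ C * C * gw N x := by positivity
      constructor
      · rw [norm_pow, norm_norm, pow_two]; linarith
      · rw [norm_mul, Real.norm_of_nonneg (zero_le_two)]
        have : ‖(conj (u s x) * v s x).re‖ ≤ ‖u s x‖ * ‖v s x‖ := by
          refine (Complex.abs_re_le_norm _).trans ?_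
          rw [norm_mul, RCLike.norm_conj]
        linarith
    · intro t
      have e : (fun x => 2 * (conj (u t x) * v t x).re) = fun x =>
          2 * ε * (conj (u t x) * D t x + aS (a x) (p t x) (p t x)).im := by
        funext x
        rw [Complex.add_im, aS_im _ (has x), hD]
        have : conj (u t x) * (Complex.I * ((ε⁻¹ : ℝ) : ℂ) * v t x + (((ε ^ 2)⁻¹ * c x : ℝ) : ℂ) * u t x)
          = ((ε⁻¹ : ℝ) : ℂ) * (Complex.I * (conj (u t x) * v t x)) + (((ε ^ 2)⁻¹ * c x : ℝ) : ℂ) * ((‖u t x‖ ^ 2 : ℝ) : ℂ) := by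
          rw [← nsq]; ring
        rw [this, Complex.add_im, Complex.im_ofReal_mul, Complex.im_ofReal_mul, Complex.ofReal_im, Complex.I_mul_im]
        field_simp
        ring
      rw [e, integral_const_mul]
      have : ∫ x, (conj (u t x) * D t x + aS (a x) (p t x) (p t x)).im =
        (∫ x, (conj (u t x) * D t x + aS (a x) (p t x) (p t x))).im :=
          Complex.imCLM.integral_comp_comm (ibp1 t).1
      rw [this, (ibp1 t).2]; simp
  -- energy
  let f : ℝ → EuclideanSpace ℝ (Fin N) → ℝ := fun t x =>
    (aS (a x) (p t x) (p t x)).re + (ε ^ 2)⁻¹ * c x * ‖u t x‖ ^ 2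
  have hfc : ∀ t, Continuous (f t) := fun t =>
    (Complex.continuous_re.comp (aS_cont a ca _ _ (cp t) (cp t))).add
      ((continuous_const.mul hc).mul ((cu t).norm.pow 2))
  have cbd : ∀ x, ‖(ε ^ 2)⁻¹ * c x‖ ≤ (ε ^ 2)⁻¹ * M := by
    intro x
    rw [norm_mul, Real.norm_of_nonneg (by positivity : 0 ≤ (ε^2)⁻¹)]
    gcongr
    exact hcM x
  have hfb : ∀ t, ∃ C, ∀ s ∈ Set.Icc (t-1) (t+1), ∀ x, ‖f s x‖ ≤ C * gw N x ∧
      ‖2 * (aS (a x) (q s x) (p s x)).re + (ε ^ 2)⁻¹ * c x * (2 * (conj (u s x) * v s x).re)‖ ≤ C * gw N x := by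
    intro t
    obtain ⟨C, hC, hb⟩ := hbd t
    refine ⟨2 * (N * (N * (β * (C * C)))) + (ε ^ 2)⁻¹ * M * (2 * (C * C)), fun s hs x => ?_⟩
    obtain ⟨b1, b2, b3, b4⟩ := hb s hs x
    have g0 := gw_pos x
    have P1 := hprod C x _ _ hC (norm_nonneg _) (norm_nonneg _) b1 b1
    have P2 := hprod C x _ _ hC (norm_nonneg _) (norm_nonneg _) b1 b2
    have P0 : 0 ≤ C * C * gw N x := by positivity
    have hg1 : C * gw N x ≤ C := mul_le_of_le_one_right hC (gw_le x)
    have hg0 : 0 ≤ C * gw N x := by positivity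
    have A1 := (Complex.abs_re_le_norm _).trans
      (aS_norm (a x) β (hab x) (p s x) (p s x) (C * gw N x) C hg0 hC hβ.le b3 (fun k => (b3 k).trans hg1))
    have A2 := (Complex.abs_re_le_norm _).trans
      (aS_norm (a x) β (hab x) (q s x) (p s x) (C * gw N x) C hg0 hC hβ.le b4 (fun k => (b3 k).trans hg1))
    have A0 : 0 ≤ N * (C * gw N x * (N * (β * C))) := by positivity
    have R : ‖(conj (u s x) * v s x).re‖ ≤ C * C * gw N x := by
      refine (Complex.abs_re_le_norm _).trans ?_
      rw [norm_mul, RCLike.norm_conj]; exact P2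
    constructor
    · refine (norm_add_le _ _).trans ?_
      have : ‖(ε ^ 2)⁻¹ * c x * ‖u s x‖ ^ 2‖ ≤ (ε ^ 2)⁻¹ * M * (2 * (C * C * gw N x)) := by
        rw [norm_mul]
        refine mul_le_mul (cbd x) ?_ (norm_nonneg _) (by positivity)
        rw [norm_pow, norm_norm, pow_two]; linarith
      rw [Real.norm_eq_abs (Complex.re _)]
      nlinarith
    · refine (norm_add_le _ _).trans ?_
      have : ‖(ε ^ 2)⁻¹ * c x * (2 * (conj (u s x) * v s x).re)‖ ≤ (ε ^ 2)⁻¹ * M * (2 * (C * C * gw N x)) := by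
        rw [norm_mul]
        refine mul_le_mul (cbd x) ?_ (norm_nonneg _) (by positivity)
        rw [norm_mul, Real.norm_of_nonneg zero_le_two]; linarith
      rw [norm_mul, Real.norm_of_nonneg zero_le_two, Real.norm_eq_abs (Complex.re _)]
      nlinarith
  have consE : ∀ t, ∫ x, f t x = ∫ x, f 0 x := by
    refine cons_aux f (fun t x => 2 * (aS (a x) (q t x) (p t x)).re
        + (ε ^ 2)⁻¹ * c x * (2 * (conj (u t x) * v t x).re)) hfc (fun t => ?_) (fun t x => ?_) hfb ?_
    · exact (continuous_const.mul (Complex.continuous_re.comp (aS_cont a ca _ _ (cq t) (cp t)))).add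
        ((continuous_const.mul hc).mul (continuous_const.mul (Complex.continuous_re.comp
        ((Complex.continuous_conj.comp (cu t)).mul (cv t)))))
    · exact (aS_deriv (a x) (has x) (fun s => p s x) (q t x) t (fun k => hmix t x _)).add
        ((dnorm t x).const_mul _)
    · intro t
      have e : (fun x => 2 * (aS (a x) (q t x) (p t x)).re
        + (ε ^ 2)⁻¹ * c x * (2 * (conj (u t x) * v t x).re)) = fun x =>
          2 * (conj (v t x) * D t x + aS (a x) (q t x) (p t x)).re := by
        funext x
        rw [Complex.add_re, hD]
        have : conj (v t x) * (Complex.I * ((ε⁻¹ : ℝ) : ℂ) * v t x + (((ε ^ 2)⁻¹ * c x : ℝ) : ℂ) * u t x)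
          = ((ε⁻¹ : ℝ) : ℂ) * (Complex.I * ((‖v t x‖ ^ 2 : ℝ) : ℂ)) + (((ε ^ 2)⁻¹ * c x : ℝ) : ℂ) * (conj (conj (u t x) * v t x)) := by
          rw [← nsq, map_mul, Complex.conj_conj]; ring
        rw [this, Complex.add_re, Complex.re_ofReal_mul, Complex.re_ofReal_mul, Complex.conj_re, Complex.I_mul_re, Complex.ofReal_im]
        ring
      rw [e, integral_const_mul]
      have : ∫ x, (conj (v t x) * D t x + aS (a x) (q t x) (p t x)).re =
        (∫ x, (conj (v t x) * D t x + aS (a x) (q t x) (p t x))).re :=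
          Complex.reCLM.integral_comp_comm (ibp2 t).1
      rw [this, (ibp2 t).2]; simp
  -- integrability and the pointwise comparison
  have iu : ∀ t, Integrable (fun x => ‖u t x‖ ^ 2) := by
    intro t
    obtain ⟨C, hC, hb⟩ := hbd t
    refine gw_integrable ((cu t).norm.pow 2) (C * C) fun x => ?_
    obtain ⟨b1, -⟩ := hb t (hself t) x
    rw [norm_pow, norm_norm, pow_two]
    exact hprod C x _ _ hC (norm_nonneg _) (norm_nonneg _) b1 b1
  have ip : ∀ t, Integrable (fun x => ∑ j, ‖p t x j‖ ^ 2) := by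
    intro t
    obtain ⟨C, hC, hb⟩ := hbd t
    refine integrable_finsetSum _ fun j _ => ?_
    refine gw_integrable ((cp t j).norm.pow 2) (C * C) fun x => ?_
    obtain ⟨-, -, b3, -⟩ := hb t (hself t) x
    rw [norm_pow, norm_norm, pow_two]
    exact hprod C x _ _ hC (norm_nonneg _) (norm_nonneg _) (b3 j) (b3 j)
  have iF : ∀ t, Integrable (f t) := by
    intro t
    obtain ⟨C, hC⟩ := hfb t
    exact gw_integrable (hfc t) C fun x => (hC t (hself t) x).1
  have cmp : ∀ t x, α * ∑ j, ‖p t x j‖ ^ 2 - (ε ^ 2)⁻¹ * M * ‖u t x‖ ^ 2 ≤ f t x ∧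
      f t x ≤ β * ∑ j, ‖p t x j‖ ^ 2 + (ε ^ 2)⁻¹ * M * ‖u t x‖ ^ 2 := by
    intro t x
    have h1 := hell x (fun k => (p t x k).re)
    have h2 := hell x (fun k => (p t x k).im)
    have h3 := abs_le.mp (cbd x)
    have h4 := mul_le_mul_of_nonneg_right h3.1 (sq_nonneg ‖u t x‖)
    have h5 := mul_le_mul_of_nonneg_right h3.2 (sq_nonneg ‖u t x‖)
    simp only [f]
    rw [sum_normsq, aS_re]
    constructor <;> linarith [h1.1, h1.2, h2.1, h2.2]
  have lower : α * ∫ x, ∑ j, ‖p t x j‖ ^ 2 ≤ ∫ x, f t x + (ε ^ 2)⁻¹ * M * ‖u t x‖ ^ 2 := by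
    rw [← integral_const_mul]
    refine integral_mono ((ip t).const_mul _) ((iF t).add ((iu t).const_mul _)) fun x => ?_
    have := (cmp t x).1
    simp only [Pi.add_apply]
    linarith
  have upper : ∫ x, f 0 x ≤ ∫ x, β * ∑ j, ‖p 0 x j‖ ^ 2 + (ε ^ 2)⁻¹ * M * ‖u 0 x‖ ^ 2 :=
    integral_mono (iF 0) (((ip 0).const_mul _).add ((iu 0).const_mul _)) fun x => (cmp 0 x).2
  rw [integral_add (iF t) ((iu t).const_mul _), integral_const_mul, consL2 t, consE t] at lower
  rw [integral_add ((ip 0).const_mul _) ((iu 0).const_mul _), integral_const_mul, integral_const_mul] at upper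
  refine final_aux α β M ε _ _ _ hα hβ.le hM hε (integral_nonneg fun x => by positivity)
    (integral_nonneg fun x => by positivity) (integral_nonneg fun x => by positivity) ?_
  change α * (∫ x, ∑ j, ‖p t x j‖ ^ 2) - _ ≤ β * (∫ x, ∑ j, ‖p 0 x j‖ ^ 2) + _
  linarith
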